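/- arXiv:2403.03763 — 2 statements merged into one kernel-verified Lean document; each statement's English description precedes it below -/
import Mathlib

section
/- Let S be a non-associative ring, R a subring of S containing the identity 1 of S, and x ∈ S (with powers x^0 = 1, x^{i+1} = x^i·x) such that: (F1) every element of S can be written uniquely as a finite sum Σ_i r_i·x^i with r_i ∈ R; (F2) for every r ∈ R there exist elements σ(r), δ(r) ∈ R with x·r = σ(r)·x + δ(r) (these are uniquely determined by (F1), and the resulting maps σ, δ : R → R are additive with σ(1) = 1, δ(1) = 0); and (F3) for all m, n ∈ ℕ and r, s ∈ R, (r·x^{m+1})(s·x^n) = ((r·x^m)(σ(s)·x^n))·x + (r·x^m)(δ(s)·x^n) and r·(s·x^n) = τ_n(r,s)·x^n. Then there is a ring isomorphism S → R[X;σ,δ]^fl that fixes every element of R and sends x to X (and more generally sends r·x^n to rX^n). -/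
/-- The π-functions `piFun σ δ m i = π_i^m`. -/
def piFun {R : Type*} [NonAssocRing R] (σ δ : R → R) : ℕ → ℕ → R → R
  | 0, 0, r => r
  | 0, _+1, _ => 0
  | m+1, 0, r => δ (piFun σ δ m 0 r)
  | m+1, i+1, r => σ (piFun σ δ m i r) + δ (piFun σ δ m (i+1) r)

/-- `tau n r s = rs` if `n` is even and `sr` if `n` is odd. -/
def tau {R : Type*} [NonAssocRing R] (n : ℕ) (r s : R) : R :=
  if Even n then r * s else s * r

/-- The multiplication of the flipped generalized polynomial ring `R[X;σ,δ]^fl`: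
the biadditive extension of `(rX^m)(sX^n) = Σ_i τ_n(r, π_i^m(s)) X^{i+n}`. Polynomials
are represented as finitely supported functions `ℕ →₀ R`. -/
noncomputable def flipMul {R : Type*} [NonAssocRing R] (σ δ : R → R) (p q : ℕ →₀ R) : ℕ →₀ R :=
  p.sum fun m r => q.sum fun n s =>
    ∑ i ∈ Finset.range (m+1), Finsupp.single (i+n) (tau n r (piFun σ δ m i s))

/-- Powers of an element of a non-associative ring: `x^0 = 1`, `x^{i+1} = x^i · x`. -/
def xpow {S : Type*} [NonAssocRing S] (x : S) : ℕ → S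
  | 0 => 1
  | n+1 => xpow x n * x

theorem piFun_eq_zero_of_lt {R : Type*} [NonAssocRing R] (σ δ : R →+ R) {m i : ℕ} (h : m < i)
    (r : R) : piFun σ δ m i r = 0 := by
  induction m generalizing i with
  | zero => obtain _ | i := i <;> simp_all [piFun]
  | succ m ih =>
    obtain _ | i := i
    · omega
    · simp [piFun, ih (i := i) (by omega), ih (i := i + 1) (by omega)]

theorem piFun_succ_zero {R : Type*} [NonAssocRing R] (σ δ : R →+ R) (m : ℕ) (r : R) :
    piFun σ δ (m + 1) 0 r = piFun σ δ m 0 (δ r) := by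
  induction m with
  | zero => simp [piFun]
  | succ m ih => rw [piFun, ih, piFun]

/-- The recursion for the π-functions, with the extra factor applied first rather than last. -/
theorem piFun_succ_succ {R : Type*} [NonAssocRing R] (σ δ : R →+ R) (m i : ℕ) (r : R) :
    piFun σ δ (m + 1) (i + 1) r = piFun σ δ m i (σ r) + piFun σ δ m (i + 1) (δ r) := by
  induction m generalizing i with
  | zero => cases i <;> simp [piFun]
  | succ m ih =>
    rw [piFun, ih i]
    cases i with
    | zero => rw [piFun_succ_zero, piFun, piFun]; simp only [map_add]; abel
    | succ i => rw [ih, piFun, piFun]; simp only [map_add]; abel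

theorem tau_add {R : Type*} [NonAssocRing R] (n : ℕ) (r s t : R) :
    tau n r (s + t) = tau n r s + tau n r t := by
  unfold tau; split_ifs <;> simp [mul_add, add_mul]

theorem tau_zero {R : Type*} [NonAssocRing R] (n : ℕ) (r : R) : tau n r 0 = 0 := by
  unfold tau; split_ifs <;> simp

/-- In a flipped Ore extension, products of monomials are given by the π-functions. -/
theorem monomial_mul_monomial {R S : Type*} [NonAssocRing R] [NonAssocRing S] (ι : R →+ S)
    (hι1 : ι 1 = 1) (x : S) (σ δ : R →+ R) (hσ : σ 1 = 1) (hδ : δ 1 = 0)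
    (hF3a : ∀ (m n : ℕ) (r s : R),
      (ι r * xpow x (m+1)) * (ι s * xpow x n)
        = ((ι r * xpow x m) * (ι (σ s) * xpow x n)) * x
          + (ι r * xpow x m) * (ι (δ s) * xpow x n))
    (hF3b : ∀ (n : ℕ) (r s : R), ι r * (ι s * xpow x n) = ι (tau n r s) * xpow x n)
    (m n : ℕ) (r s : R) :
    (ι r * xpow x m) * (ι s * xpow x n) =
      ∑ i ∈ Finset.range (m+1), ι (tau n r (piFun σ δ m i s)) * xpow x (i+n) := by
  have hx (k : ℕ) (a : R) : ι a * xpow x k * x = ι a * xpow x (k + 1) := by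
    have h := hF3a k 0 a 1
    simp only [hσ, hδ, hι1, map_zero, mul_zero, add_zero, xpow, mul_one] at h
    exact h.symm
  induction m generalizing s with
  | zero => simp [piFun, xpow, hF3b]
  | succ m ih =>
    have hδs : ∑ i ∈ Finset.range (m+1), ι (tau n r (piFun σ δ m i (δ s))) * xpow x (i+n) =
        ∑ i ∈ Finset.range (m+2), ι (tau n r (piFun σ δ m i (δ s))) * xpow x (i+n) := by
      rw [Finset.sum_range_succ _ (m+1), piFun_eq_zero_of_lt σ δ (Nat.lt_succ_self m)]
      simp [tau_zero]
    rw [hF3a, ih, ih, hδs, Finset.sum_mul, Finset.sum_range_succ' _ (m+1),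
      Finset.sum_range_succ' _ (m+1), ← add_assoc, ← Finset.sum_add_distrib, piFun_succ_zero]
    congr 1
    refine Finset.sum_congr rfl fun i _ => ?_
    rw [hx, piFun_succ_succ, tau_add, map_add, add_mul, add_right_comm i n 1]

/-- every flipped non-associative Ore extension `S` of `R` (here `R` is realized
as a subring of `S` via an injective unital multiplicative additive embedding `ι`) is
isomorphic, as a ring, to the flipped generalized polynomial ring `R[X;σ,δ]^fl`, via an
isomorphism fixing `R` pointwise and sending `r·x^n` to `rX^n` (in particular `x ↦ X`). -/
theorem flipped_ore_extension_iso_flipped_generalized_polynomial_ring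
    {R S : Type*} [NonAssocRing R] [NonAssocRing S]
    (ι : R →+ S) (hinj : Function.Injective ι)
    (hι1 : ι 1 = 1) (hιmul : ∀ a b : R, ι (a * b) = ι a * ι b)
    (x : S) (σ δ : R →+ R) (hσ : σ 1 = 1) (hδ : δ 1 = 0)
    -- (F1): every element of `S` is uniquely a finite sum `Σ_i r_i · x^i` with `r_i ∈ R`
    (hF1 : ∀ p : S, ∃! c : ℕ →₀ R, p = c.sum fun i r => ι r * xpow x i)
    -- (F2): `x·r = σ(r)·x + δ(r)`
    (hF2 : ∀ r : R, x * ι r = ι (σ r) * x + ι (δ r))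
    -- (F3): `(r·x^{m+1})(s·x^n) = ((r·x^m)(σ(s)·x^n))·x + (r·x^m)(δ(s)·x^n)`
    (hF3a : ∀ (m n : ℕ) (r s : R),
      (ι r * xpow x (m+1)) * (ι s * xpow x n)
        = ((ι r * xpow x m) * (ι (σ s) * xpow x n)) * x
          + (ι r * xpow x m) * (ι (δ s) * xpow x n))
    -- (F3): `r·(s·x^n) = τ_n(r,s)·x^n`
    (hF3b : ∀ (n : ℕ) (r s : R), ι r * (ι s * xpow x n) = ι (tau n r s) * xpow x n) :
    ∃ φ : S ≃+ (ℕ →₀ R),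
      (∀ p q : S, φ (p * q) = flipMul (σ : R → R) (δ : R → R) (φ p) (φ q)) ∧
      (∀ r : R, φ (ι r) = Finsupp.single 0 r) ∧
      φ x = Finsupp.single 1 1 ∧
      (∀ (n : ℕ) (r : R), φ (ι r * xpow x n) = Finsupp.single n r) := by
  let ψ : (ℕ →₀ R) →+ S :=
    Finsupp.liftAddHom fun i => (AddMonoidHom.mulRight (xpow x i)).comp ι
  have hψ (c : ℕ →₀ R) : ψ c = c.sum fun i r => ι r * xpow x i := rfl
  have hψs (n : ℕ) (r : R) : ψ (Finsupp.single n r) = ι r * xpow x n := by simp [hψ]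
  have hbij : Function.Bijective ψ :=
    (Function.bijective_iff_existsUnique _).2 fun p => by
      simpa only [hψ, eq_comm] using hF1 p
  have hmul (p q : ℕ →₀ R) : ψ (flipMul σ δ p q) = ψ p * ψ q := by
    simp only [flipMul, map_finsuppSum, map_sum, hψs]
    simp only [hψ, Finsupp.sum, Finset.sum_mul_sum,
      monomial_mul_monomial ι hι1 x σ δ hσ hδ hF3a hF3b]
  let e : (ℕ →₀ R) ≃+ S := AddEquiv.ofBijective ψ hbij
  have he (c : ℕ →₀ R) : e c = ψ c := rfl
  have hmono (n : ℕ) (r : R) : e.symm (ι r * xpow x n) = Finsupp.single n r := by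
    rw [AddEquiv.symm_apply_eq, he, hψs]
  refine ⟨e.symm, fun p q => ?_, fun r => ?_, ?_, hmono⟩
  · rw [AddEquiv.symm_apply_eq, he, hmul, ← he, ← he, e.apply_symm_apply, e.apply_symm_apply]
  · simpa [xpow] using hmono 0 r
  · simpa [xpow, hι1] using hmono 1 1
end

section
/- In S = R[X;σ,δ]^fl, the element X lies in the right nucleus N_r(S) (i.e. (p·q)·X = p·(q·X) for all p, q ∈ S) if and only if R is commutative. -/
theorem piFun_one {R : Type*} [NonAssocRing R] (σ δ : R →+ R) (hσ : σ 1 = 1) (hδ : δ 1 = 0)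
    (m i : ℕ) : piFun (σ : R → R) (δ : R → R) m i 1 = if i = m then 1 else 0 := by
  induction m generalizing i with
  | zero => cases i <;> simp [piFun]
  | succ m ih =>
    cases i with
    | zero =>
      rw [piFun, ih]
      split_ifs <;> simp_all
    | succ i =>
      rw [piFun, ih, ih]
      split_ifs <;> simp_all

theorem piFun_apply_zero {R : Type*} [NonAssocRing R] (σ δ : R →+ R) (m i : ℕ) :
    piFun (σ : R → R) (δ : R → R) m i 0 = 0 := by
  induction m generalizing i with
  | zero => cases i <;> simp [piFun]
  | succ m ih => cases i <;> simp [piFun, ih]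

/-- Right multiplication by `X` shifts exponents by one. -/
theorem flipMul_X {R : Type*} [NonAssocRing R] (σ δ : R →+ R) (hσ : σ 1 = 1) (hδ : δ 1 = 0)
    (p : ℕ →₀ R) :
    flipMul (σ : R → R) (δ : R → R) p (Finsupp.single 1 1) = p.mapDomain (· + 1) := by
  unfold flipMul Finsupp.mapDomain
  refine Finsupp.sum_congr fun m _ => ?_
  rw [Finsupp.sum_single_index (by simp [tau, piFun_apply_zero]),
    Finset.sum_eq_single_of_mem m (by simp)]
  · simp [tau, piFun_one σ δ hσ hδ]
  · intro i _ him
    simp [tau, piFun_one σ δ hσ hδ, him]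

theorem flipMul_single_zero {R : Type*} [NonAssocRing R] (σ δ : R →+ R) (r s : R) (n : ℕ) :
    flipMul (σ : R → R) (δ : R → R) (Finsupp.single 0 r) (Finsupp.single n s) =
      Finsupp.single n (tau n r s) := by
  unfold flipMul
  rw [Finsupp.sum_single_index, Finsupp.sum_single_index] <;>
    simp [tau, piFun]

/-- in `S = R[X;σ,δ]^fl`, `X` lies in the right nucleus `N_r(S)` if and only
if `R` is commutative. -/
theorem X_mem_rightNucleus_iff {R : Type*} [NonAssocRing R]
    (σ δ : R →+ R) (hσ : σ 1 = 1) (hδ : δ 1 = 0) :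
    (∀ p q : ℕ →₀ R,
      flipMul (σ : R → R) (δ : R → R)
          (flipMul (σ : R → R) (δ : R → R) p q) (Finsupp.single 1 1)
        = flipMul (σ : R → R) (δ : R → R) p
            (flipMul (σ : R → R) (δ : R → R) q (Finsupp.single 1 1))) ↔
    (∀ r s : R, r * s = s * r) := by
  simp only [flipMul_X σ δ hσ hδ]
  constructor
  · intro h r s
    have := h (Finsupp.single 0 r) (Finsupp.single 0 s)
    simp only [Finsupp.mapDomain_single, flipMul_single_zero] at this
    simpa [tau] using Finsupp.single_injective _ this
  · intro h p q
    have htau : ∀ (n : ℕ) (r s : R), tau n r s = r * s := fun n r s => by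
      unfold tau
      split_ifs
      · rfl
      · exact h s r
    unfold flipMul
    simp only [htau, Finsupp.sum_mapDomain_index_inj (add_left_injective 1)]
    simp only [Finsupp.sum, Finsupp.mapDomain_finsetSum, Finsupp.mapDomain_single, add_assoc]
end
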